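/- arXiv:1403.3632 — 5 statements merged into one kernel-verified Lean document; each statement's English description precedes it below -/
import Mathlib

section
/- Let B be a real Banach space whose norm satisfies condition (*) with parameters s ∈ [2,∞) and m > 0, and let T : B → B be a bounded linear operator with ‖Tf‖ ≤ ‖f‖ for all f ∈ B. Then for every integer r ≥ 1 and every f ∈ B one has ‖(T−I)^r f‖^s ≥ 2^{−rs} ‖(T²−I)^r f‖^s + m 2^{−s} ‖(T−I)^{r+1} f‖^s. -/
/-- If `T` is a contraction, then `‖(T + 1)^n g‖ ≤ 2^n ‖g‖`. -/
theorem norm_add_one_pow_apply_le {B : Type*} [NormedAddCommGroup B] [NormedSpace ℝ B]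
    (T : B →L[ℝ] B) (hT : ∀ f : B, ‖T f‖ ≤ ‖f‖) (n : ℕ) (g : B) :
    ‖((T + 1 : B →L[ℝ] B) ^ n) g‖ ≤ 2 ^ n * ‖g‖ := by
  induction n with
  | zero => simp
  | succ n ih =>
    have h : ((T + 1 : B →L[ℝ] B) ^ (n + 1)) g
        = T (((T + 1 : B →L[ℝ] B) ^ n) g) + ((T + 1 : B →L[ℝ] B) ^ n) g := by
      rw [pow_succ']
      rfl
    rw [h]
    refine (norm_add_le _ _).trans ?_
    have := hT (((T + 1 : B →L[ℝ] B) ^ n) g)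
    rw [pow_succ]
    linarith

/-- Condition (*) applied to `(g + T g) / 2` and `(g - T g) / 2` for a contraction `T`. -/
theorem rpow_norm_half_add_le {B : Type*} [NormedAddCommGroup B] [NormedSpace ℝ B]
    {s m : ℝ} (hs : 0 < s) (hm : 0 ≤ m)
    (hstar : ∀ F G : B, (‖F‖ ^ s + m * ‖G‖ ^ s) ^ (1 / s) ≤ max ‖F + G‖ ‖F - G‖)
    (T : B →L[ℝ] B) (hT : ∀ f : B, ‖T f‖ ≤ ‖f‖) (g : B) :
    (‖(T + 1 : B →L[ℝ] B) g‖ / 2) ^ s + m * (‖(T - 1 : B →L[ℝ] B) g‖ / 2) ^ s ≤ ‖g‖ ^ s := by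
  have key := hstar ((1 / 2 : ℝ) • (T + 1 : B →L[ℝ] B) g) ((1 / 2 : ℝ) • (T - 1 : B →L[ℝ] B) g)
  have e1 : (1 / 2 : ℝ) • (T + 1 : B →L[ℝ] B) g + (1 / 2 : ℝ) • (T - 1 : B →L[ℝ] B) g = T g := by
    simp only [add_apply, sub_apply,
      one_apply_eq_self]
    module
  have e2 : (1 / 2 : ℝ) • (T + 1 : B →L[ℝ] B) g - (1 / 2 : ℝ) • (T - 1 : B →L[ℝ] B) g = g := by
    simp only [add_apply, sub_apply,
      one_apply_eq_self]
    module
  have e3 (x : B) : ‖(1 / 2 : ℝ) • x‖ = ‖x‖ / 2 := by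
    rw [norm_smul, Real.norm_of_nonneg (by norm_num)]
    ring
  rw [e1, e2, max_eq_right (hT g), e3, e3, one_div,
    Real.rpow_inv_le_iff_of_pos (by positivity) (norm_nonneg _) hs] at key
  exact key


/-- If the norm of a Banach space `B` satisfies condition (*) with parameters
`s ∈ [2,∞)` and `m > 0`, and `T : B → B` is a bounded linear contraction, then for every
integer `r ≥ 1` and every `f ∈ B`:
`‖(T−I)^r f‖^s ≥ 2^{−rs} ‖(T²−I)^r f‖^s + m 2^{−s} ‖(T−I)^{r+1} f‖^s`. -/
theorem stmt0 {B : Type*} [NormedAddCommGroup B] [NormedSpace ℝ B] [CompleteSpace B]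
    (s m : ℝ) (hs : 2 ≤ s) (hm : 0 < m)
    (hstar : ∀ F G : B, (‖F‖ ^ s + m * ‖G‖ ^ s) ^ (1 / s) ≤ max ‖F + G‖ ‖F - G‖)
    (T : B →L[ℝ] B) (hT : ∀ f : B, ‖T f‖ ≤ ‖f‖)
    (r : ℕ) (hr : 1 ≤ r) (f : B) :
    (2 : ℝ) ^ (-(r : ℝ) * s) * ‖((T ^ 2 - 1 : B →L[ℝ] B) ^ r) f‖ ^ s
        + m * (2 : ℝ) ^ (-s) * ‖((T - 1 : B →L[ℝ] B) ^ (r + 1)) f‖ ^ s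
      ≤ ‖((T - 1 : B →L[ℝ] B) ^ r) f‖ ^ s := by
  have hs0 : 0 < s := by linarith
  set g := ((T - 1 : B →L[ℝ] B) ^ r) f
  have hcomm : Commute (T + 1 : B →L[ℝ] B) (T - 1) :=
    ((Commute.refl T).sub_right (Commute.one_right T)).add_left (Commute.one_left _)
  have hfac : (T ^ 2 - 1 : B →L[ℝ] B) = (T + 1) * (T - 1) := by
    noncomm_ring
  have h1 : ((T ^ 2 - 1 : B →L[ℝ] B) ^ r) f = ((T + 1 : B →L[ℝ] B) ^ r) g := by
    rw [hfac, hcomm.mul_pow]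
    rfl
  have h2 : ((T - 1 : B →L[ℝ] B) ^ (r + 1)) f = (T - 1 : B →L[ℝ] B) g := by
    rw [pow_succ']
    rfl
  have key := rpow_norm_half_add_le hs0 hm.le hstar T hT g
  have hle : (2 : ℝ) ^ (-(r : ℝ)) * ‖((T + 1 : B →L[ℝ] B) ^ r) g‖
      ≤ ‖(T + 1 : B →L[ℝ] B) g‖ / 2 := by
    obtain ⟨n, rfl⟩ := Nat.exists_eq_add_of_le' hr
    have h := norm_add_one_pow_apply_le T hT n ((T + 1 : B →L[ℝ] B) g)
    have hsplit : ((T + 1 : B →L[ℝ] B) ^ (n + 1)) g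
        = ((T + 1 : B →L[ℝ] B) ^ n) ((T + 1 : B →L[ℝ] B) g) := by
      rw [pow_succ]
      rfl
    rw [hsplit, Real.rpow_neg zero_le_two, Real.rpow_natCast, inv_mul_le_iff₀ (by positivity),
      pow_succ]
    linarith
  have hle' := Real.rpow_le_rpow (by positivity) hle hs0.le
  rw [Real.mul_rpow (by positivity) (norm_nonneg _), ← Real.rpow_mul zero_le_two] at hle'
  have h3 : (‖(T - 1 : B →L[ℝ] B) g‖ / 2) ^ s
      = (2 : ℝ) ^ (-s) * ‖(T - 1 : B →L[ℝ] B) g‖ ^ s := by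
    rw [Real.div_rpow (norm_nonneg _) zero_le_two, Real.rpow_neg zero_le_two]
    ring
  rw [h1, h2, mul_assoc]
  rw [h3] at key
  linarith
end

section
/- Let Φ be a Young function with lim_{x→∞} Φ(x)/x = ∞, let 1 < s < ∞, and suppose that the function u ↦ Φ(u^{1/s}) is concave on [0,∞). Let Ψ(y) = sup{xy − Φ(x) : x ≥ 0} be the complementary Young function and let q satisfy 1/s + 1/q = 1. Then the function t ↦ Ψ(t^{1/q}) is convex on [0,∞) (as a function with values in [0,∞]). -/
open scoped ENNReal

/-- The complementary Young function `Ψ(y) = sup{xy − Φ(x) : x ≥ 0}`, as a function with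
values in `[0,∞]`. -/
noncomputable def complYoung (Φ : ℝ → ℝ) (y : ℝ) : ℝ≥0∞ :=
  ⨆ (x : ℝ) (_ : 0 ≤ x), ENNReal.ofReal (x * y - Φ x)

/-- Each value `x * y - Φ x` with `x ≥ 0` is a lower bound for `complYoung Φ y`. -/
theorem ofReal_le_complYoung (Φ : ℝ → ℝ) (y : ℝ) {x : ℝ} (hx : 0 ≤ x) :
    ENNReal.ofReal (x * y - Φ x) ≤ complYoung Φ y :=
  le_iSup₂_of_le x hx le_rfl

/-- If `u = x ^ s` is scaled by `a / t`, the product `u ^ (1 / s) * a ^ (1 / q)` becomes linear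
in `a`. -/
theorem rpow_rescale_mul_rpow {s q x t a : ℝ} (hs : s ≠ 0) (hq : 1 / s + 1 / q = 1)
    (hx : 0 ≤ x) (ht : 0 < t) (ha : 0 ≤ a) :
    (x ^ s * (a / t)) ^ (1 / s) * a ^ (1 / q) = x * t ^ (1 / q) * (a / t) := by
  have hat : 0 ≤ a / t := div_nonneg ha ht.le
  have hxs : (x ^ s) ^ (1 / s) = x := by
    rw [← Real.rpow_mul hx, mul_one_div_cancel hs, Real.rpow_one]
  have hsplit : (a / t) ^ (1 / s) * (a / t) ^ (1 / q) = a / t := by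
    rw [← Real.rpow_add' hat (by rw [hq]; exact one_ne_zero), hq, Real.rpow_one]
  have haq : a ^ (1 / q) = t ^ (1 / q) * (a / t) ^ (1 / q) := by
    rw [← Real.mul_rpow ht.le hat, mul_div_cancel₀ _ ht.ne']
  rw [Real.mul_rpow (Real.rpow_nonneg hx s) hat, hxs, haq]
  linear_combination x * t ^ (1 / q) * hsplit

/-- Let `Φ` be a Young function with `lim_{x→∞} Φ(x)/x = ∞`, let `1 < s < ∞`,
and suppose `u ↦ Φ(u^{1/s})` is concave on `[0,∞)`. Let `Ψ` be the complementary Young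
function and `1/s + 1/q = 1`. Then `t ↦ Ψ(t^{1/q})` is convex on `[0,∞)` (with values in
`[0,∞]`), i.e. it satisfies the defining inequality of convexity. -/
theorem stmt5 (Φ : ℝ → ℝ)
    (hconv : ConvexOn ℝ (Set.Ici 0) Φ) (hmono : MonotoneOn Φ (Set.Ici 0)) (h0 : Φ 0 = 0)
    (hlim : Filter.Tendsto (fun x => Φ x / x) Filter.atTop Filter.atTop)
    (s q : ℝ) (hs1 : 1 < s) (hq : 1 / s + 1 / q = 1)
    (hconc : ConcaveOn ℝ (Set.Ici 0) (fun u => Φ (u ^ (1 / s))))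
    (t₁ t₂ lam : ℝ) (ht₁ : 0 ≤ t₁) (ht₂ : 0 ≤ t₂) (hlam0 : 0 ≤ lam) (hlam1 : lam ≤ 1) :
    complYoung Φ (((1 - lam) * t₁ + lam * t₂) ^ (1 / q))
      ≤ ENNReal.ofReal (1 - lam) * complYoung Φ (t₁ ^ (1 / q))
        + ENNReal.ofReal lam * complYoung Φ (t₂ ^ (1 / q)) := by
  have hs0 : s ≠ 0 := by positivity
  have hq0 : 1 / q ≠ 0 := by
    have : 1 / s < 1 := by rw [div_lt_one (by positivity)]; exact hs1
    linarith
  have hlam0' : 0 ≤ 1 - lam := sub_nonneg.2 hlam1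
  refine iSup₂_le fun x hx => ?_
  set t := (1 - lam) * t₁ + lam * t₂ with ht
  have ht0 : 0 ≤ t := by positivity
  rcases ht0.eq_or_lt with h | htpos
  · have hΦ : 0 ≤ Φ x := h0 ▸ hmono Set.self_mem_Ici hx hx
    rw [← h, Real.zero_rpow hq0, ENNReal.ofReal_of_nonpos (by linarith)]
    exact zero_le
  set u : ℝ → ℝ := fun a => x ^ s * (a / t) with hu
  have hu0 : ∀ {a}, 0 ≤ a → 0 ≤ u a := fun ha =>
    mul_nonneg (Real.rpow_nonneg hx s) (div_nonneg ha ht0)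
  have hsum : (1 - lam) * (t₁ / t) + lam * (t₂ / t) = 1 := by
    rw [← mul_div_assoc, ← mul_div_assoc, ← add_div, ← ht, div_self htpos.ne']
  have hconc' : (1 - lam) * Φ (u t₁ ^ (1 / s)) + lam * Φ (u t₂ ^ (1 / s)) ≤ Φ x := by
    have h := hconc.2 (hu0 ht₁) (hu0 ht₂) hlam0' hlam0 (sub_add_cancel 1 lam)
    have hcomb : (1 - lam) * u t₁ + lam * u t₂ = x ^ s := by
      linear_combination x ^ s * hsum
    simp only [smul_eq_mul] at h
    rwa [hcomb, ← Real.rpow_mul hx, mul_one_div_cancel hs0, Real.rpow_one] at h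
  have e₁ := rpow_rescale_mul_rpow hs0 hq hx htpos ht₁
  have e₂ := rpow_rescale_mul_rpow hs0 hq hx htpos ht₂
  have key : x * t ^ (1 / q) - Φ x
      ≤ (1 - lam) * (u t₁ ^ (1 / s) * t₁ ^ (1 / q) - Φ (u t₁ ^ (1 / s)))
        + lam * (u t₂ ^ (1 / s) * t₂ ^ (1 / q) - Φ (u t₂ ^ (1 / s))) := by
    rw [e₁, e₂]
    linear_combination hconc' - x * t ^ (1 / q) * hsum
  refine (ENNReal.ofReal_le_ofReal key).trans (ENNReal.ofReal_add_le.trans ?_)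
  rw [ENNReal.ofReal_mul hlam0', ENNReal.ofReal_mul hlam0]
  gcongr
  · exact ofReal_le_complYoung Φ _ (Real.rpow_nonneg (hu0 ht₁) _)
  · exact ofReal_le_complYoung Φ _ (Real.rpow_nonneg (hu0 ht₂) _)
end

section
/- Let r ≥ (3+√5)/2 and define Φ(u) = u^r (1 + |ln u|) for u > 0 and Φ(0) = 0. Then Φ is convex and increasing on [0,∞) (hence a Young function); for every s > r there exist 0 < a < b such that the function u ↦ Φ(u^{1/s}) is concave on [0,a] and concave on [b,∞); and for s = r the function u ↦ Φ(u^{1/r}) is strictly convex on (1,∞), so no such b exists in that case. -/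
/-- `Φ(u) = u^r (1 + |ln u|)` for `u ≠ 0`, and `Φ(0) = 0`. -/
noncomputable def Phi9 (r : ℝ) (u : ℝ) : ℝ :=
  if u = 0 then 0 else u ^ r * (1 + |Real.log u|)

open Real Set

/-- A function that is convex on both sides of `c` and has a supporting line at `c` is convex. -/
lemma convexOn_Ici_of_supporting_line {f : ℝ → ℝ} {a c m : ℝ}
    (hl : ConvexOn ℝ (Icc a c) f) (hr : ConvexOn ℝ (Ici c) f)
    (hm : ∀ x ∈ Ici a, f c + m * (x - c) ≤ f x) : ConvexOn ℝ (Ici a) f := by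
  refine convexOn_of_slope_mono_adjacent (convex_Ici a) fun {x y z} hx hz hxy hyz => ?_
  have hax : a ≤ x := hx
  rcases le_total z c with hzc | hcz
  · exact hl.slope_mono_adjacent ⟨hax, by linarith⟩ ⟨by linarith, hzc⟩ hxy hyz
  rcases le_total c x with hcx | hxc
  · exact hr.slope_mono_adjacent hcx hcz hxy hyz
  rcases hxc.eq_or_lt with rfl | hxc
  · exact hr.slope_mono_adjacent self_mem_Ici hcz hxy hyz
  rcases hcz.eq_or_lt with rfl | hcz
  · exact hl.slope_mono_adjacent ⟨hax, by linarith⟩ ⟨by linarith, le_rfl⟩ hxy hyz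
  have hmx := mul_nonneg (sub_nonneg.2 hcz.le) (sub_nonneg.2 (hm x hx))
  have hmz := mul_nonneg (sub_nonneg.2 hxc.le) (sub_nonneg.2 (hm z hz))
  have hc : (z - x) * f c ≤ (z - c) * f x + (c - x) * f z := by nlinarith
  suffices h : (z - x) * f y ≤ (z - y) * f x + (y - x) * f z by
    rw [div_le_div_iff₀ (sub_pos.2 hxy) (sub_pos.2 hyz)]
    nlinarith
  rcases lt_trichotomy y c with hyc | rfl | hcy
  · have h := hl.secant_mono_aux1 ⟨hax, hxc.le⟩ ⟨by linarith, le_rfl⟩ hxy hyc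
    have h₁ := mul_le_mul_of_nonneg_left h (sub_pos.2 (hxy.trans hyz)).le
    have h₂ := mul_le_mul_of_nonneg_left hc (sub_pos.2 hxy).le
    refine le_of_mul_le_mul_left ?_ (sub_pos.2 hxc)
    linarith
  · exact hc
  · have h := hr.secant_mono_aux1 self_mem_Ici (show z ∈ Ici c from hcz.le) hcy hyz
    have h₁ := mul_le_mul_of_nonneg_left h (sub_pos.2 (hxy.trans hyz)).le
    have h₂ := mul_le_mul_of_nonneg_left hc (sub_pos.2 hyz).le
    refine le_of_mul_le_mul_left ?_ (sub_pos.2 hcz)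
    linarith

/-- The family `u ^ p * (c + d * log u)`, which is closed under differentiation. -/
noncomputable def rpowLog (p c d u : ℝ) : ℝ := u ^ p * (c + d * log u)

lemma continuousOn_rpowLog {p : ℝ} (hp : 0 < p) (c d : ℝ) :
    ContinuousOn (rpowLog p c d) (Ici 0) := by
  have hpow : Continuous fun u : ℝ => u ^ p := continuous_id.rpow_const fun _ => Or.inr hp.le
  have h : Continuous fun u : ℝ => c * u ^ p + d / p * (u ^ p * log (u ^ p)) :=
    (hpow.const_mul c).add ((continuous_mul_log.comp hpow).const_mul _)
  refine h.continuousOn.congr fun u hu => ?_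
  rcases (mem_Ici.1 hu).eq_or_lt with rfl | hu
  · simp [rpowLog, zero_rpow hp.ne']
  · simp only [rpowLog, log_rpow hu]
    field_simp

lemma hasDerivAt_rpowLog (p c d : ℝ) {u : ℝ} (hu : 0 < u) :
    HasDerivAt (rpowLog p c d) (rpowLog (p - 1) (p * c + d) (p * d) u) u := by
  have h := (hasDerivAt_rpow_const (p := p) (Or.inl hu.ne')).mul
    (((hasDerivAt_log hu.ne').const_mul d).const_add c)
  refine h.congr_deriv ?_
  rw [rpowLog, rpow_sub_one hu.ne']
  field_simp
  ring

lemma convexOn_rpowLog {p c d : ℝ} (hp : 0 < p) {D : Set ℝ} (hD : Convex ℝ D) (hD₀ : D ⊆ Ici 0)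
    (h : ∀ u ∈ interior D, 0 ≤ p * (p - 1) * c + (2 * p - 1) * d + p * (p - 1) * d * log u) :
    ConvexOn ℝ D (rpowLog p c d) := by
  have hpos : ∀ u ∈ interior D, 0 < u := fun u hu => by
    simpa using interior_mono hD₀ hu
  refine convexOn_of_hasDerivWithinAt2_nonneg hD ((continuousOn_rpowLog hp c d).mono hD₀)
    (fun u hu => (hasDerivAt_rpowLog p c d (hpos u hu)).hasDerivWithinAt)
    (fun u hu => (hasDerivAt_rpowLog _ _ _ (hpos u hu)).hasDerivWithinAt) fun u hu => ?_
  refine mul_nonneg (rpow_nonneg (hpos u hu).le _) ?_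
  linarith [h u hu]

lemma concaveOn_rpowLog {p c d : ℝ} (hp : 0 < p) {D : Set ℝ} (hD : Convex ℝ D) (hD₀ : D ⊆ Ici 0)
    (h : ∀ u ∈ interior D, p * (p - 1) * c + (2 * p - 1) * d + p * (p - 1) * d * log u ≤ 0) :
    ConcaveOn ℝ D (rpowLog p c d) := by
  rw [← neg_convexOn_iff]
  have hneg : -rpowLog p c d = rpowLog p (-c) (-d) := by
    funext u
    simp only [rpowLog, Pi.neg_apply]
    ring
  rw [hneg]
  exact convexOn_rpowLog hp hD hD₀ fun u hu => by linarith [h u hu]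

lemma Phi9_rpow_eq {r s : ℝ} (hr : 0 < r) (hs : 0 < s) {u : ℝ} (hu : 0 ≤ u) :
    Phi9 r (u ^ (1 / s)) = u ^ (r / s) * (1 + |log u| / s) := by
  rcases hu.eq_or_lt with rfl | hu
  · simp [Phi9, zero_rpow (div_pos hr hs).ne', zero_rpow (inv_pos.2 hs).ne']
  · rw [Phi9, if_neg (rpow_pos_of_pos hu _).ne', ← rpow_mul hu.le, log_rpow hu, abs_mul,
      abs_of_pos (one_div_pos.2 hs)]
    congr 2 <;> ring

lemma Phi9_rpow_eq_of_le_one {r s : ℝ} (hr : 0 < r) (hs : 0 < s) {u : ℝ} (hu : 0 ≤ u)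
    (hu₁ : u ≤ 1) : Phi9 r (u ^ (1 / s)) = rpowLog (r / s) 1 (-(1 / s)) u := by
  rw [Phi9_rpow_eq hr hs hu, abs_of_nonpos (log_nonpos hu hu₁), rpowLog]
  ring

lemma Phi9_rpow_eq_of_one_le {r s : ℝ} (hr : 0 < r) (hs : 0 < s) {u : ℝ} (hu : 1 ≤ u) :
    Phi9 r (u ^ (1 / s)) = rpowLog (r / s) 1 (1 / s) u := by
  rw [Phi9_rpow_eq hr hs (by linarith), abs_of_nonneg (log_nonneg hu), rpowLog]
  ring

lemma rpow_le_Phi9 {r u : ℝ} (hr : 0 < r) (hu : 0 ≤ u) : u ^ r ≤ Phi9 r u := by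
  have h := Phi9_rpow_eq hr one_pos hu
  simp only [div_one, rpow_one] at h
  rw [h]
  nlinarith [rpow_nonneg hu r, abs_nonneg (log u)]

lemma Phi9_zero (r : ℝ) : Phi9 r 0 = 0 := if_pos rfl

lemma convexOn_Phi9 {r : ℝ} (hr : (3 + √5) / 2 ≤ r) : ConvexOn ℝ (Ici 0) (Phi9 r) := by
  have h5 : √5 ^ 2 = 5 := sq_sqrt (by norm_num)
  have h5' : 0 ≤ √5 := sqrt_nonneg 5
  have hr₁ : 1 < r := by linarith
  have hr₀ : 0 < r := by linarith
  have hq : 0 ≤ r ^ 2 - 3 * r + 1 := by nlinarith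
  have hrr : 0 < r * (r - 1) := mul_pos hr₀ (by linarith)
  refine convexOn_Ici_of_supporting_line (c := 1) (m := r) ?_ ?_ fun x hx => ?_
  · refine (convexOn_rpowLog (c := 1) (d := -1) hr₀ (convex_Icc 0 1)
      Icc_subset_Ici_self fun u hu => ?_).congr fun u hu => ?_
    · rw [interior_Icc] at hu
      have := mul_nonneg hrr.le (neg_nonneg.2 (log_nonpos hu.1.le hu.2.le))
      nlinarith
    · simpa using (Phi9_rpow_eq_of_le_one hr₀ one_pos hu.1 hu.2).symm
  · refine (convexOn_rpowLog (c := 1) (d := 1) hr₀ (convex_Ici 1)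
      (Ici_subset_Ici.2 zero_le_one) fun u hu => ?_).congr fun u hu => ?_
    · rw [interior_Ici] at hu
      have := mul_nonneg hrr.le (log_nonneg (mem_Ioi.1 hu).le)
      nlinarith
    · simpa using (Phi9_rpow_eq_of_one_le hr₀ one_pos hu).symm
  · have hx : 0 ≤ x := hx
    have hb := one_add_mul_self_le_rpow_one_add (s := x - 1) (by linarith) hr₁.le
    rw [add_sub_cancel] at hb
    have h1 : Phi9 r 1 = 1 := by simp [Phi9]
    rw [h1]
    exact hb.trans (rpow_le_Phi9 hr₀ hx)

lemma monotoneOn_Ici_of_convexOn {f : ℝ → ℝ} (hf : ConvexOn ℝ (Ici 0) f)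
    (h₀ : ∀ x ∈ Ici 0, f 0 ≤ f x) : MonotoneOn f (Ici 0) := by
  intro x hx y hy hxy
  by_contra! h
  rcases (mem_Ici.1 hx).eq_or_lt with rfl | hx'
  · exact absurd (h₀ y hy) h.not_ge
  have hxy' : x < y := hxy.lt_of_ne fun e => by simp [e] at h
  have := hf.secant_mono_aux1 self_mem_Ici hy hx' hxy'
  nlinarith [mul_pos hx' (sub_pos.2 h),
    mul_nonneg (sub_pos.2 hxy').le (sub_nonneg.2 (h₀ x hx))]

lemma exists_concaveOn_Phi9_rpow {r s : ℝ} (hr : 0 < r) (hrs : r < s) :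
    ∃ a b : ℝ, 0 < a ∧ a < b ∧
      ConcaveOn ℝ (Icc 0 a) (fun u => Phi9 r (u ^ (1 / s))) ∧
      ConcaveOn ℝ (Ici b) (fun u => Phi9 r (u ^ (1 / s))) := by
  have hs : 0 < s := hr.trans hrs
  set p := r / s
  have hp₀ : 0 < p := div_pos hr hs
  have hp₁ : p < 1 := (div_lt_one hs).2 hrs
  have hq : 0 < p * (1 - p) := mul_pos hp₀ (by linarith)
  have hd : 0 < 1 / s := one_div_pos.2 hs
  obtain ⟨K, hK₀, hK⟩ : ∃ K : ℝ, 0 < K ∧ |2 * p - 1| ≤ p * (1 - p) * K :=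
    ⟨|2 * p - 1| / (p * (1 - p)) + 1, by positivity, by
      rw [mul_add, mul_div_cancel₀ _ hq.ne']
      linarith⟩
  obtain ⟨hK₁, hK₂⟩ := abs_le.1 hK
  have ha : exp (-K) ≤ 1 := exp_le_one_iff.2 (by linarith)
  have hb : 1 ≤ exp K := one_le_exp hK₀.le
  refine ⟨exp (-K), exp K, exp_pos _, exp_lt_exp.2 (by linarith), ?_, ?_⟩
  · refine (concaveOn_rpowLog (c := 1) (d := -(1 / s)) hp₀ (convex_Icc 0 _)
      Icc_subset_Ici_self fun u hu => ?_).congr fun u hu => ?_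
    · rw [interior_Icc] at hu
      have hlog : log u ≤ -K := (log_le_iff_le_exp hu.1).2 hu.2.le
      have h := mul_le_mul_of_nonneg_left hlog hq.le
      have : 0 ≤ (1 / s) * ((2 * p - 1) - p * (1 - p) * log u) := mul_nonneg hd.le (by linarith)
      linarith
    · exact (Phi9_rpow_eq_of_le_one hr hs hu.1 (hu.2.trans ha)).symm
  · refine (concaveOn_rpowLog (c := 1) (d := 1 / s) hp₀ (convex_Ici _)
      (Ici_subset_Ici.2 (exp_pos K).le) fun u hu => ?_).congr fun u hu => ?_
    · rw [interior_Ici] at hu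
      have hu₀ : 0 < u := (exp_pos K).trans hu
      have hlog : K ≤ log u := (le_log_iff_exp_le hu₀).2 (mem_Ioi.1 hu).le
      have h := mul_le_mul_of_nonneg_left hlog hq.le
      have : 0 ≤ (1 / s) * (p * (1 - p) * log u - (2 * p - 1)) := mul_nonneg hd.le (by linarith)
      linarith
    · exact (Phi9_rpow_eq_of_one_le hr hs (hb.trans hu)).symm

lemma strictConvexOn_Phi9_rpow_self {r : ℝ} (hr : 0 < r) :
    StrictConvexOn ℝ (Ioi 1) (fun u => Phi9 r (u ^ (1 / r))) := by
  have hsub : Ioi (1 : ℝ) ⊆ Ici 0 := fun u hu => zero_le_one.trans (mem_Ioi.1 hu).le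
  refine StrictConvexOn.congr (f := fun u => u + (1 / r) * (u * log u)) ?_ fun u hu => ?_
  · exact (convexOn_id (convex_Ioi 1)).add_strictConvexOn
      ⟨convex_Ioi 1, fun x hx y hy hxy a b ha hb hab => by
        have h := strictConvexOn_mul_log.2 (hsub hx) (hsub hy) hxy ha hb hab
        have h' := mul_lt_mul_of_pos_left h (one_div_pos.2 hr)
        simp only [smul_eq_mul] at h' ⊢
        linarith⟩
  · dsimp only
    rw [Phi9_rpow_eq_of_one_le hr hr (mem_Ioi.1 hu).le, div_self hr.ne', rpowLog, rpow_one]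
    ring


/-- For `r ≥ (3+√5)/2`, the function `Φ(u) = u^r(1+|ln u|)` (with `Φ(0)=0`)
is convex and increasing on `[0,∞)` (hence a Young function); for every `s > r` there are
`0 < a < b` such that `u ↦ Φ(u^{1/s})` is concave on `[0,a]` and on `[b,∞)`; and for
`s = r` the function `u ↦ Φ(u^{1/r})` is strictly convex on `(1,∞)`. -/
theorem stmt9 (r : ℝ) (hr : (3 + Real.sqrt 5) / 2 ≤ r) :
    ConvexOn ℝ (Set.Ici 0) (Phi9 r) ∧ MonotoneOn (Phi9 r) (Set.Ici 0) ∧ Phi9 r 0 = 0 ∧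
    (∀ s : ℝ, r < s → ∃ a b : ℝ, 0 < a ∧ a < b ∧
      ConcaveOn ℝ (Set.Icc 0 a) (fun u => Phi9 r (u ^ (1 / s))) ∧
      ConcaveOn ℝ (Set.Ici b) (fun u => Phi9 r (u ^ (1 / s)))) ∧
    StrictConvexOn ℝ (Set.Ioi 1) (fun u => Phi9 r (u ^ (1 / r))) := by
  have hr₀ : 0 < r := by linarith [Real.sqrt_nonneg 5]
  have hconv := convexOn_Phi9 hr
  refine ⟨hconv, monotoneOn_Ici_of_convexOn hconv fun x hx => ?_, Phi9_zero r,
    fun s hs => exists_concaveOn_Phi9_rpow hr₀ hs, strictConvexOn_Phi9_rpow_self hr₀⟩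
  rw [Phi9_zero]
  exact (rpow_nonneg hx r).trans (rpow_le_Phi9 hr₀ hx)
end

section
/- Let p ≥ 1 and α with αp ≥ 1, and define Φ(u) = u^p (ln(2+u))^{αp} for u ≥ 0. Then for every s > p there exist 0 < a < b such that the function u ↦ Φ(u^{1/s}) is concave on [0,a] and concave on [b,∞); and for s = p the function u ↦ Φ(u^{1/p}) has strictly positive second derivative for u > 0, so it is strictly convex on (0,∞). -/
/-- The Zygmund-type Young function `Φ(u) = u^p (ln(2+u))^{αp}`. -/
noncomputable def Phi10 (p α : ℝ) (u : ℝ) : ℝ :=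
  u ^ p * Real.log (2 + u) ^ (α * p)

open Filter Topology

/-- The logarithmic derivative `x ↦ x / ((2 + x) ln(2 + x))` of `ln ln(2 + x)` with respect to
`ln x`. -/
noncomputable def logElasticity (x : ℝ) : ℝ :=
  x / ((2 + x) * Real.log (2 + x))

theorem log_two_add_pos {x : ℝ} (hx : 0 ≤ x) : 0 < Real.log (2 + x) :=
  Real.log_pos (by linarith)

theorem logElasticity_pos {x : ℝ} (hx : 0 < x) : 0 < logElasticity x := by
  have := log_two_add_pos hx.le
  unfold logElasticity
  positivity

theorem tendsto_logElasticity_zero : Tendsto logElasticity (𝓝 0) (𝓝 0) := by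
  have h2 : (2 + (0 : ℝ)) * Real.log (2 + 0) ≠ 0 :=
    mul_ne_zero (by norm_num) (log_two_add_pos le_rfl).ne'
  have hc : ContinuousAt logElasticity 0 := by
    unfold logElasticity
    refine continuousAt_id.div ?_ h2
    exact (by fun_prop : ContinuousAt (fun x : ℝ => 2 + x) 0).mul
      ((by fun_prop : ContinuousAt (fun x : ℝ => 2 + x) 0).log (by norm_num))
  simpa [ContinuousAt, logElasticity] using hc

theorem tendsto_logElasticity_atTop : Tendsto logElasticity atTop (𝓝 0) := by
  have hlog : Tendsto (fun x : ℝ => (Real.log (2 + x))⁻¹) atTop (𝓝 0) :=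
    (Real.tendsto_log_atTop.comp (tendsto_atTop_add_const_left _ 2 tendsto_id)).inv_tendsto_atTop
  refine squeeze_zero' ?_ ?_ hlog
  · filter_upwards [eventually_gt_atTop 0] with x hx using (logElasticity_pos hx).le
  · filter_upwards [eventually_gt_atTop 0] with x hx
    have hl := log_two_add_pos hx.le
    unfold logElasticity
    rw [div_le_iff₀ (by positivity)]
    field_simp
    linarith

theorem hasDerivAt_logElasticity {x : ℝ} (hx : 0 < x) :
    HasDerivAt logElasticity (logElasticity x * (2 / (2 + x) - logElasticity x) / x) x := by
  have hl := log_two_add_pos hx.le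
  have h2 : HasDerivAt (fun x : ℝ => 2 + x) 1 x := (hasDerivAt_id x).const_add 2
  have h := (hasDerivAt_id x).div (h2.mul (h2.log (by positivity)))
    (mul_pos (by positivity) hl).ne'
  refine h.congr_deriv ?_
  simp only [logElasticity, id, Pi.mul_apply]
  field_simp
  ring

/-- The derivative of `u ↦ Φ(u^e)`. -/
theorem hasDerivAt_Phi10_rpow (p α e : ℝ) {u : ℝ} (hu : 0 < u) :
    HasDerivAt (fun v => Phi10 p α (v ^ e))
      (e * (Phi10 p α (u ^ e) * (p + α * p * logElasticity (u ^ e)) / u)) u := by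
  have hx : 0 < u ^ e := Real.rpow_pos_of_pos hu e
  have hl := log_two_add_pos hx.le
  have hxd : HasDerivAt (fun v : ℝ => v ^ e) (e * u ^ (e - 1)) u :=
    Real.hasDerivAt_rpow_const (Or.inl hu.ne')
  have h2 := hxd.const_add 2
  have h := (hxd.rpow_const (p := p) (Or.inl hx.ne')).mul
    ((h2.log (by positivity)).rpow_const (p := α * p) (Or.inl hl.ne'))
  refine h.congr_deriv ?_
  rw [Real.rpow_sub_one hx.ne', Real.rpow_sub_one hl.ne', Real.rpow_sub_one hu.ne']
  simp only [Phi10, logElasticity]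
  field_simp

/-- The second derivative of `u ↦ Φ(u^e)`. -/
theorem hasDerivAt_deriv_Phi10_rpow (p α e : ℝ) {u : ℝ} (hu : 0 < u) :
    HasDerivAt
      (fun v => e * (Phi10 p α (v ^ e) * (p + α * p * logElasticity (v ^ e)) / v))
      (e * Phi10 p α (u ^ e) / u ^ 2 *
        (e * ((p + α * p * logElasticity (u ^ e)) ^ 2 + α * p * logElasticity (u ^ e) *
          (2 / (2 + u ^ e) - logElasticity (u ^ e))) - (p + α * p * logElasticity (u ^ e)))) u := by
  have hx : 0 < u ^ e := Real.rpow_pos_of_pos hu e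
  have hxd : HasDerivAt (fun v : ℝ => v ^ e) (e * u ^ (e - 1)) u :=
    Real.hasDerivAt_rpow_const (Or.inl hu.ne')
  have hm := (((hasDerivAt_logElasticity hx).comp u hxd).const_mul (α * p)).const_add p
  have h := (((hasDerivAt_Phi10_rpow p α e hu).mul hm).div (hasDerivAt_id u) hu.ne').const_mul e
  refine h.congr_deriv ?_
  rw [Real.rpow_sub_one hu.ne']
  simp only [id, Pi.mul_apply, Function.comp_apply]
  generalize logElasticity (u ^ e) = m
  generalize Phi10 p α (u ^ e) = f
  field_simp

theorem Phi10_pos (p α : ℝ) {x : ℝ} (hx : 0 < x) : 0 < Phi10 p α x :=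
  mul_pos (Real.rpow_pos_of_pos hx _) (Real.rpow_pos_of_pos (log_two_add_pos hx.le) _)

theorem continuousOn_Phi10_rpow {p α e : ℝ} (hp : 0 ≤ p) (he : 0 ≤ e) :
    ContinuousOn (fun v => Phi10 p α (v ^ e)) (Set.Ici 0) := by
  have hx : ContinuousOn (fun v : ℝ => v ^ e) (Set.Ici 0) :=
    continuousOn_id.rpow_const fun _ _ => Or.inr he
  refine (hx.rpow_const fun _ _ => Or.inr hp).mul (ContinuousOn.rpow_const ?_ ?_)
  · refine (continuousOn_const.add hx).log fun v hv => ?_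
    have : 0 ≤ v ^ e := Real.rpow_nonneg hv e
    exact (by linarith : 0 < 2 + v ^ e).ne'
  · exact fun v hv => Or.inl (log_two_add_pos (Real.rpow_nonneg hv e)).ne'

/-- If the logarithmic term is negligible on the interior of `D ⊆ [0, ∞)`, then
`u ↦ Φ(u^{1/s})` is concave on `D`. -/
theorem concaveOn_Phi10_rpow {p α s : ℝ} (hp : 0 ≤ p) (hα : 0 ≤ α * p) (hs : 0 < s)
    {D : Set ℝ} (hD : Convex ℝ D) (hD0 : D ⊆ Set.Ici 0)
    (h : ∀ u ∈ interior D, (p + α * p * logElasticity (u ^ (1 / s))) ^ 2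
      + α * p * logElasticity (u ^ (1 / s))
      - s * (p + α * p * logElasticity (u ^ (1 / s))) < 0) :
    ConcaveOn ℝ D (fun u => Phi10 p α (u ^ (1 / s))) := by
  have hpos : ∀ u ∈ interior D, 0 < u := fun u hu => by
    simpa using interior_mono hD0 hu
  refine concaveOn_of_hasDerivWithinAt2_nonpos hD
    ((continuousOn_Phi10_rpow hp (by positivity)).mono hD0)
    (fun u hu => (hasDerivAt_Phi10_rpow p α (1 / s) (hpos u hu)).hasDerivWithinAt)
    (fun u hu => (hasDerivAt_deriv_Phi10_rpow p α (1 / s) (hpos u hu)).hasDerivWithinAt)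
    (fun u hu => ?_)
  have hu0 := hpos u hu
  have hx : 0 < u ^ (1 / s) := Real.rpow_pos_of_pos hu0 _
  have hf := Phi10_pos p α hx
  have hm := logElasticity_pos hx
  have hb := h u hu
  have hq : 2 / (2 + u ^ (1 / s)) ≤ 1 := by
    rw [div_le_one (by positivity)]
    linarith
  generalize logElasticity (u ^ (1 / s)) = m at *
  generalize 2 / (2 + u ^ (1 / s)) = q at *
  refine mul_nonpos_of_nonneg_of_nonpos (by positivity) ?_
  have hle : α * p * m * (q - m) ≤ α * p * m :=
    mul_le_of_le_one_right (by positivity) (by linarith)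
  rw [sub_nonpos, one_div, inv_mul_le_iff₀ hs]
  linarith

theorem iteratedDeriv_two_Phi10_rpow_pos {p α : ℝ} (hp : 0 < p) (hα : 1 ≤ α * p) {u : ℝ}
    (hu : 0 < u) : 0 < iteratedDeriv 2 (fun v => Phi10 p α (v ^ (1 / p))) u := by
  have hd : deriv (fun v => Phi10 p α (v ^ (1 / p))) =ᶠ[𝓝 u] fun v =>
      1 / p * (Phi10 p α (v ^ (1 / p)) * (p + α * p * logElasticity (v ^ (1 / p))) / v) := by
    filter_upwards [Ioi_mem_nhds hu] with v hv using (hasDerivAt_Phi10_rpow p α (1 / p) hv).deriv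
  rw [iteratedDeriv_succ, iteratedDeriv_one, hd.deriv_eq,
    (hasDerivAt_deriv_Phi10_rpow p α (1 / p) hu).deriv]
  have hx : 0 < u ^ (1 / p) := Real.rpow_pos_of_pos hu _
  have hf := Phi10_pos p α hx
  have hm := logElasticity_pos hx
  generalize logElasticity (u ^ (1 / p)) = m at *
  have hq : 0 < 2 / (2 + u ^ (1 / p)) := by positivity
  generalize 2 / (2 + u ^ (1 / p)) = q at *
  refine mul_pos (by positivity) ?_
  have hβ : 0 < α * p := by linarith
  rw [sub_pos, one_div, lt_inv_mul_iff₀ hp]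
  generalize α * p = β at *
  have h1 : 0 < p * β * m := by positivity
  have h2 : 0 ≤ β * (β - 1) * m ^ 2 :=
    mul_nonneg (mul_nonneg hβ.le (by linarith)) (by positivity)
  have h3 : 0 < β * m * q := by positivity
  nlinarith


/-- Let `p ≥ 1` and `αp ≥ 1`, and `Φ(u) = u^p (ln(2+u))^{αp}`. Then for every
`s > p` there are `0 < a < b` such that `u ↦ Φ(u^{1/s})` is concave on `[0,a]` and on
`[b,∞)`; and for `s = p` the function `u ↦ Φ(u^{1/p})` has strictly positive second
derivative for `u > 0`, so it is strictly convex on `(0,∞)`. -/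
theorem stmt10 (p α : ℝ) (hp : 1 ≤ p) (hαp : 1 ≤ α * p) :
    (∀ s : ℝ, p < s → ∃ a b : ℝ, 0 < a ∧ a < b ∧
      ConcaveOn ℝ (Set.Icc 0 a) (fun u => Phi10 p α (u ^ (1 / s))) ∧
      ConcaveOn ℝ (Set.Ici b) (fun u => Phi10 p α (u ^ (1 / s)))) ∧
    (∀ u : ℝ, 0 < u → 0 < iteratedDeriv 2 (fun v => Phi10 p α (v ^ (1 / p))) u) ∧
    StrictConvexOn ℝ (Set.Ioi 0) (fun u => Phi10 p α (u ^ (1 / p))) := by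
  have hp0 : 0 < p := by linarith
  have hα0 : 0 ≤ α * p := by linarith
  refine ⟨fun s hs => ?_, fun u hu => iteratedDeriv_two_Phi10_rpow_pos hp0 hαp hu, ?_⟩
  · have hs0 : 0 < s := hp0.trans hs
    have hev : ∀ {l : Filter ℝ}, Tendsto (fun u : ℝ => logElasticity (u ^ (1 / s))) l (𝓝 0) →
        ∀ᶠ u in l, (p + α * p * logElasticity (u ^ (1 / s))) ^ 2
          + α * p * logElasticity (u ^ (1 / s))
          - s * (p + α * p * logElasticity (u ^ (1 / s))) < 0 := fun hl => by
      have hc : Continuous fun m : ℝ => (p + α * p * m) ^ 2 + α * p * m - s * (p + α * p * m) := by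
        fun_prop
      refine ((hc.tendsto 0).comp hl).eventually_lt_const ?_
      nlinarith
    have h0 : Tendsto (fun u : ℝ => u ^ (1 / s)) (𝓝 0) (𝓝 0) := by
      have := (Real.continuousAt_rpow_const 0 (1 / s) (Or.inr (by positivity))).tendsto
      rwa [Real.zero_rpow (by positivity)] at this
    obtain ⟨a, ha, hsub⟩ := Metric.eventually_nhds_iff.1 (hev (tendsto_logElasticity_zero.comp h0))
    obtain ⟨b, hb⟩ := eventually_atTop.1
      (hev (tendsto_logElasticity_atTop.comp (tendsto_rpow_atTop (by positivity : 0 < 1 / s))))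
    refine ⟨a, max b (a + 1), ha, by linarith [le_max_right b (a + 1)],
      concaveOn_Phi10_rpow hp0.le hα0 hs0 (convex_Icc _ _) (fun u hu => hu.1) fun u hu => ?_,
      concaveOn_Phi10_rpow hp0.le hα0 hs0 (convex_Ici _) (fun u hu => ?_) fun u hu => ?_⟩
    · rw [interior_Icc] at hu
      refine hsub ?_
      rw [Real.dist_eq, sub_zero, abs_of_pos hu.1]
      exact hu.2
    · have : max b (a + 1) ≤ u := hu
      exact Set.mem_Ici.2 (by linarith [le_max_right b (a + 1)])
    · exact hb u ((le_max_left _ _).trans (interior_subset hu))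
  · refine strictConvexOn_of_deriv2_pos' (convex_Ioi 0)
      ((continuousOn_Phi10_rpow hp0.le (by positivity)).mono Set.Ioi_subset_Ici_self) fun u hu => ?_
    rw [← iteratedDeriv_eq_iterate]
    exact iteratedDeriv_two_Phi10_rpow_pos hp0 hαp hu
end

section
/- Let B be a real Banach space whose norm satisfies condition (*) with parameters s ∈ [2,∞) and m > 0, and let (T(t))_{t≥0} be a holomorphic C₀ semigroup of contractions on B with infinitesimal generator A. Then for every integer r ≥ 1 there is a constant C > 0 such that for all f ∈ B and t > 0: K_{A^r}(f, t^r) ≥ C ( ∑_{j=1}^∞ 2^{−jrs} K_{A^{r+1}}(f, 2^{j(r+1)} t^{r+1})^s )^{1/s}. -/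
open Filter

/-- `g = Af`, where `A` is the infinitesimal generator of the semigroup `T`:
`Af = lim_{t→0+} (T(t)f − f)/t` (limit in norm). -/
def GenRel {B : Type*} [NormedAddCommGroup B] [NormedSpace ℝ B]
    (T : ℝ → B →L[ℝ] B) (f g : B) : Prop :=
  Tendsto (fun t : ℝ => t⁻¹ • (T t f - f)) (nhdsWithin 0 (Set.Ioi 0)) (nhds g)

/-- `g = A^k f` for the infinitesimal generator `A` of `T`, defined by iterating `GenRel`;
in particular `f ∈ D(A^k)` iff some `g` satisfies `GenRelIter T k f g`. -/
def GenRelIter {B : Type*} [NormedAddCommGroup B] [NormedSpace ℝ B]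
    (T : ℝ → B →L[ℝ] B) : ℕ → B → B → Prop
  | 0, f, g => f = g
  | (k + 1), f, g => ∃ h : B, GenRelIter T k f h ∧ GenRel T h g

/-- The K-functional `K_{A^r}(f, u) = inf{‖f − g‖ + u‖A^r g‖ : g ∈ D(A^r)}`. -/
noncomputable def KFun {B : Type*} [NormedAddCommGroup B] [NormedSpace ℝ B]
    (T : ℝ → B →L[ℝ] B) (r : ℕ) (f : B) (u : ℝ) : ℝ :=
  sInf {v : ℝ | ∃ g h : B, GenRelIter T r g h ∧ v = ‖f - g‖ + u * ‖h‖}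

/-- A `C₀` semigroup of linear contractions. -/
structure IsContractionSemigroup {B : Type*} [NormedAddCommGroup B] [NormedSpace ℝ B]
    (T : ℝ → B →L[ℝ] B) : Prop where
  zero : T 0 = 1
  add : ∀ t u : ℝ, 0 ≤ t → 0 ≤ u → T (t + u) = T t ∘L T u
  tendsto : ∀ f : B, Tendsto (fun t : ℝ => T t f) (nhdsWithin 0 (Set.Ioi 0)) (nhds f)
  contr : ∀ t : ℝ, 0 ≤ t → ∀ f : B, ‖T t f‖ ≤ ‖f‖

section Operators

variable {B : Type*} [NormedAddCommGroup B] [NormedSpace ℝ B]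

lemma norm_pow_apply_le {Q : B →L[ℝ] B} {c : ℝ} (hc : 0 ≤ c) (h : ∀ x, ‖Q x‖ ≤ c * ‖x‖)
    (k : ℕ) (x : B) : ‖(Q ^ k) x‖ ≤ c ^ k * ‖x‖ := by
  induction k generalizing x with
  | zero => simp
  | succ k ih =>
    rw [pow_succ, mul_apply_eq_comp, pow_succ, mul_assoc]
    exact (ih _).trans (mul_le_mul_of_nonneg_left (h x) (by positivity))

lemma norm_one_sub_apply_le {P : B →L[ℝ] B} (hP : ∀ x, ‖P x‖ ≤ ‖x‖) (x : B) :
    ‖(1 - P) x‖ ≤ 2 * ‖x‖ := by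
  have := norm_sub_le x (P x)
  have := hP x
  simp only [sub_apply, one_apply_eq_self]
  linarith

lemma norm_one_add_apply_le {P : B →L[ℝ] B} (hP : ∀ x, ‖P x‖ ≤ ‖x‖) (x : B) :
    ‖(1 + P) x‖ ≤ 2 * ‖x‖ := by
  have := norm_add_le x (P x)
  have := hP x
  simp only [add_apply, one_apply_eq_self]
  linarith

lemma norm_contraction_pow_apply_le {P : B →L[ℝ] B} (hP : ∀ x, ‖P x‖ ≤ ‖x‖) (k : ℕ) (x : B) :
    ‖(P ^ k) x‖ ≤ ‖x‖ := by
  simpa using norm_pow_apply_le zero_le_one (fun x => by simpa using hP x) k x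

lemma norm_sum_pow_apply_le {P : B →L[ℝ] B} (hP : ∀ x, ‖P x‖ ≤ ‖x‖) (n : ℕ) (x : B) :
    ‖(∑ i ∈ Finset.range n, P ^ i) x‖ ≤ n * ‖x‖ := by
  rw [sum_apply]
  refine (norm_sum_le _ _).trans ?_
  refine (Finset.sum_le_sum fun i _ => norm_contraction_pow_apply_le hP i x).trans ?_
  simp

lemma norm_one_sub_pow_pow_apply_le {P : B →L[ℝ] B} (hP : ∀ x, ‖P x‖ ≤ ‖x‖) (n p : ℕ) (x : B) :
    ‖((1 - P ^ n) ^ p) x‖ ≤ (n : ℝ) ^ p * ‖((1 - P) ^ p) x‖ := by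
  have h : (1 - P ^ n) ^ p = (∑ i ∈ Finset.range n, P ^ i) ^ p * (1 - P) ^ p := by
    have hc : Commute (∑ i ∈ Finset.range n, P ^ i) (1 - P) :=
      Commute.sum_left _ _ _ fun i _ =>
        (Commute.one_right _).sub_right ((Commute.refl P).pow_left i)
    rw [← hc.mul_pow, geom_sum_mul_neg]
  rw [h, mul_apply_eq_comp]
  exact norm_pow_apply_le (Nat.cast_nonneg n) (norm_sum_pow_apply_le hP n) p _

lemma norm_sum_one_sub_pow_apply_le {P : B →L[ℝ] B} (hP : ∀ x, ‖P x‖ ≤ ‖x‖) (p : ℕ) (x : B) :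
    ‖(∑ i ∈ Finset.range p, (1 - P) ^ i) x‖ ≤ (2 : ℝ) ^ p * ‖x‖ := by
  rw [sum_apply]
  refine (norm_sum_le _ _).trans ?_
  refine (Finset.sum_le_sum fun i _ =>
    norm_pow_apply_le zero_le_two (norm_one_sub_apply_le hP) i x).trans ?_
  rw [← Finset.sum_mul]
  refine mul_le_mul_of_nonneg_right ?_ (norm_nonneg x)
  have := geom_sum_mul (2 : ℝ) p
  linarith

/-- One doubling step of the energy inequality that condition (*) gives for a contraction. -/
lemma doubling_step {s m : ℝ} (hs : 0 < s) (hm : 0 < m)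
    (hstar : ∀ F G : B, (‖F‖ ^ s + m * ‖G‖ ^ s) ^ (1 / s) ≤ max ‖F + G‖ ‖F - G‖)
    {P : B →L[ℝ] B} (hP : ∀ x, ‖P x‖ ≤ ‖x‖) (r : ℕ) (hr : 1 ≤ r) (f : B) :
    (((2 : ℝ) ^ r)⁻¹ * ‖((1 - P ^ (2 : ℕ)) ^ r) f‖) ^ s + m * (2⁻¹ * ‖((1 - P) ^ (r + 1)) f‖) ^ s
      ≤ ‖((1 - P) ^ r) f‖ ^ s := by
  set x := ((1 - P) ^ r) f with hx
  have hG : ‖(2⁻¹ : ℝ) • (x - P x)‖ = 2⁻¹ * ‖((1 - P) ^ (r + 1)) f‖ := by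
    rw [norm_smul, pow_succ', mul_apply_eq_comp, ← hx]
    simp
  have hF : ((2 : ℝ) ^ r)⁻¹ * ‖((1 - P ^ (2 : ℕ)) ^ r) f‖ ≤ ‖(2⁻¹ : ℝ) • (x + P x)‖ := by
    obtain ⟨k, rfl⟩ : ∃ k, r = k + 1 := ⟨r - 1, by omega⟩
    have hc : Commute (1 + P) (1 - P) :=
      (Commute.one_right _).sub_right ((Commute.one_left P).add_left (Commute.refl P))
    have h1 : (1 - P ^ (2 : ℕ)) ^ (k + 1) = (1 + P) ^ k * ((1 + P) * (1 - P) ^ (k + 1)) := by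
      rw [← mul_assoc, ← pow_succ, ← hc.mul_pow]
      congr 1
      noncomm_ring
    rw [h1, mul_apply_eq_comp, mul_apply_eq_comp, ← hx]
    have h2 := norm_pow_apply_le zero_le_two (norm_one_add_apply_le hP) k ((1 + P) x)
    have h3 : (1 + P) x = x + P x := rfl
    rw [norm_smul, ← h3, pow_succ, inv_mul_le_iff₀ (by positivity)]
    refine h2.trans (le_of_eq ?_)
    norm_num
    ring
  have key := hstar ((2⁻¹ : ℝ) • (x + P x)) ((2⁻¹ : ℝ) • (x - P x))
  have e1 : (2⁻¹ : ℝ) • (x + P x) + (2⁻¹ : ℝ) • (x - P x) = x := by module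
  have e2 : (2⁻¹ : ℝ) • (x + P x) - (2⁻¹ : ℝ) • (x - P x) = P x := by module
  rw [e1, e2, max_eq_left (hP x), one_div,
    Real.rpow_inv_le_iff_of_pos (by positivity) (norm_nonneg _) hs, hG] at key
  refine le_trans ?_ key
  gcongr

end Operators

section Generator

variable {B : Type*} [NormedAddCommGroup B] [NormedSpace ℝ B] {T : ℝ → B →L[ℝ] B}

lemma GenRel.unique {f g h : B} (hg : GenRel T f g) (hh : GenRel T f h) : g = h :=
  tendsto_nhds_unique hg hh

lemma GenRel.map {Q : B →L[ℝ] B} (hQ : ∀ v, 0 < v → Commute Q (T v)) {f g : B}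
    (h : GenRel T f g) : GenRel T (Q f) (Q g) := by
  refine ((Q.continuous.tendsto g).comp h).congr' ?_
  filter_upwards [self_mem_nhdsWithin] with v hv
  have hc : Q (T v f) = T v (Q f) := DFunLike.congr_fun (hQ v hv).eq f
  simp [hc]

lemma GenRel.sub {f g f' g' : B} (h : GenRel T f g) (h' : GenRel T f' g') :
    GenRel T (f - f') (g - g') := by
  refine (Tendsto.sub h h').congr fun v => ?_
  rw [map_sub]
  module

lemma GenRelIter.unique {k : ℕ} {f g h : B} (hg : GenRelIter T k f g)
    (hh : GenRelIter T k f h) : g = h := by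
  induction k generalizing g h with
  | zero => exact hg.symm.trans hh
  | succ k ih =>
    obtain ⟨a, ha, hag⟩ := hg
    obtain ⟨b, hb, hbh⟩ := hh
    obtain rfl := ih ha hb
    exact hag.unique hbh

lemma GenRelIter.map {Q : B →L[ℝ] B} (hQ : ∀ v, 0 < v → Commute Q (T v)) {k : ℕ} {f g : B}
    (h : GenRelIter T k f g) : GenRelIter T k (Q f) (Q g) := by
  induction k generalizing g with
  | zero => exact congrArg Q h
  | succ k ih =>
    obtain ⟨a, ha, hag⟩ := h
    exact ⟨Q a, ih ha, hag.map hQ⟩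

lemma GenRelIter.zero_zero (k : ℕ) : GenRelIter T k 0 0 := by
  induction k with
  | zero => rfl
  | succ k ih => exact ⟨0, ih, by simp [GenRel]⟩

lemma KFun_nonneg (r : ℕ) (f : B) {u : ℝ} (hu : 0 ≤ u) : 0 ≤ KFun T r f u := by
  refine Real.sInf_nonneg ?_
  rintro v ⟨g, h, -, rfl⟩
  positivity

lemma KFun_le {r : ℕ} (f : B) {g h : B} {u : ℝ} (hu : 0 ≤ u) (hgh : GenRelIter T r g h) :
    KFun T r f u ≤ ‖f - g‖ + u * ‖h‖ := by
  refine csInf_le ⟨0, ?_⟩ ⟨g, h, hgh, rfl⟩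
  rintro v ⟨g, h, -, rfl⟩
  positivity

namespace IsContractionSemigroup

lemma commute (hT : IsContractionSemigroup T) {t u : ℝ} (ht : 0 ≤ t) (hu : 0 ≤ u) :
    Commute (T t) (T u) := by
  change T t ∘L T u = T u ∘L T t
  rw [← hT.add t u ht hu, ← hT.add u t hu ht, add_comm]

lemma nat_mul (hT : IsContractionSemigroup T) {t : ℝ} (ht : 0 ≤ t) (n : ℕ) :
    T (n * t) = T t ^ n := by
  induction n with
  | zero => simp [hT.zero]
  | succ n ih =>
    rw [Nat.cast_succ, add_mul, one_mul, hT.add _ _ (by positivity) ht, ih, pow_succ]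
    rfl

lemma commute_one_sub (hT : IsContractionSemigroup T) {t v : ℝ} (ht : 0 ≤ t) (hv : 0 < v) :
    Commute (1 - T t) (T v) :=
  (Commute.one_left _).sub_left (hT.commute ht hv.le)

lemma norm_apply_sub_le (hT : IsContractionSemigroup T) {x y : ℝ} (hx : 0 ≤ x) (hxy : x ≤ y)
    (g : B) : ‖T y g - T x g‖ ≤ ‖T (y - x) g - g‖ := by
  have h : T y = T x ∘L T (y - x) := by
    rw [← hT.add _ _ hx (sub_nonneg.2 hxy)]
    congr 1
    ring
  rw [h, ContinuousLinearMap.comp_apply, ← map_sub]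
  exact hT.contr x hx _

lemma continuousOn (hT : IsContractionSemigroup T) (g : B) :
    ContinuousOn (fun u => T u g) (Set.Ici 0) := by
  rw [Metric.continuousOn_iff]
  intro x hx ε hε
  have h := hT.tendsto g
  rw [Metric.tendsto_nhdsWithin_nhds] at h
  obtain ⟨δ, hδ, h⟩ := h ε hε
  refine ⟨δ, hδ, fun y hy hd => ?_⟩
  simp only [Set.mem_Ici] at hx hy
  rw [Real.dist_eq] at hd
  rcases lt_trichotomy x y with hxy | rfl | hxy
  · have h1 := h (x := y - x) (by simpa using hxy) (by simpa using hd)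
    rw [dist_eq_norm] at h1 ⊢
    exact (hT.norm_apply_sub_le hx hxy.le g).trans_lt h1
  · simpa using hε
  · have h1 := h (x := x - y) (by simpa using hxy) (by
      rw [abs_sub_comm] at hd; simpa using hd)
    rw [dist_comm, dist_eq_norm]
    rw [dist_eq_norm] at h1
    exact (hT.norm_apply_sub_le hy hxy.le g).trans_lt h1

lemma hasDerivWithinAt (hT : IsContractionSemigroup T) {g a : B} (h : GenRel T g a) {u : ℝ}
    (hu : 0 ≤ u) : HasDerivWithinAt (fun v => T v g) (T u a) (Set.Ici u) u := by
  rw [← hasDerivWithinAt_Ioi_iff_Ici, hasDerivWithinAt_iff_tendsto_slope' (by simp)]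
  have h1 : Tendsto (fun v : ℝ => v - u) (nhdsWithin u (Set.Ioi u))
      (nhdsWithin 0 (Set.Ioi 0)) := by
    refine tendsto_nhdsWithin_iff.2 ⟨?_, ?_⟩
    · have : Tendsto (fun v : ℝ => v - u) (nhds u) (nhds (u - u)) :=
        (continuous_id.sub continuous_const).tendsto u
      rw [sub_self] at this
      exact this.mono_left nhdsWithin_le_nhds
    · filter_upwards [self_mem_nhdsWithin] with v hv
      simpa using hv
  have h2 := ((T u).continuous.tendsto a).comp (Tendsto.comp h h1)
  refine h2.congr' ?_
  filter_upwards [self_mem_nhdsWithin] with v hv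
  have h3 : T v = T u ∘L T (v - u) := by
    rw [← hT.add _ _ hu (sub_nonneg.2 (le_of_lt hv))]
    congr 1
    ring
  simp [slope, h3]

lemma norm_apply_sub_sub_smul_le (hT : IsContractionSemigroup T) {g a k : B} (h : GenRel T g a)
    {t C : ℝ} (ht : 0 ≤ t) (hC : ∀ u, 0 ≤ u → u < t → ‖T u a - k‖ ≤ C) :
    ‖T t g - g - t • k‖ ≤ C * t := by
  have hd : ∀ u ∈ Set.Ico 0 t,
      HasDerivWithinAt (fun v => T v g - v • k) (T u a - k) (Set.Ici u) u := by
    intro u hu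
    refine (hT.hasDerivWithinAt h hu.1).sub ?_
    simpa using (hasDerivWithinAt_id u (Set.Ici u)).smul_const k
  have hc : ContinuousOn (fun v => T v g - v • k) (Set.Icc 0 t) :=
    ((hT.continuousOn g).mono Set.Icc_subset_Ici_self).sub (by fun_prop)
  have := norm_image_sub_le_of_norm_deriv_right_le_segment hc hd
    (fun u hu => hC u hu.1 hu.2) t ⟨ht, le_rfl⟩
  simp only [hT.zero, zero_smul, sub_zero, one_apply_eq_self] at this
  rwa [sub_right_comm] at this

lemma norm_apply_sub_le_mul (hT : IsContractionSemigroup T) {g a : B} (h : GenRel T g a)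
    {t : ℝ} (ht : 0 ≤ t) : ‖T t g - g‖ ≤ t * ‖a‖ := by
  have := hT.norm_apply_sub_sub_smul_le (k := 0) h ht (C := ‖a‖) fun u hu _ => by
    simpa using hT.contr u hu a
  simpa [mul_comm] using this

lemma norm_taylor_le (hT : IsContractionSemigroup T) {g a b : B} (h : GenRel T g a)
    (h' : GenRel T a b) {t : ℝ} (ht : 0 ≤ t) : ‖T t g - g - t • a‖ ≤ t ^ 2 * ‖b‖ := by
  have := hT.norm_apply_sub_sub_smul_le (k := a) h ht (C := t * ‖b‖) fun u hu hut =>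
    (hT.norm_apply_sub_le_mul h' hu).trans (by gcongr)
  linarith

lemma norm_one_sub_pow_apply_le_of_genRelIter (hT : IsContractionSemigroup T) {t : ℝ}
    (ht : 0 ≤ t) {k : ℕ} {g h : B} (hgh : GenRelIter T k g h) :
    ‖((1 - T t) ^ k) g‖ ≤ t ^ k * ‖h‖ := by
  induction k generalizing g h with
  | zero =>
    obtain rfl : g = h := hgh
    simp
  | succ k ih =>
    obtain ⟨a, ha, hah⟩ := hgh
    rw [pow_succ, mul_apply_eq_comp, pow_succ, mul_assoc]
    refine (ih (ha.map fun v hv => hT.commute_one_sub ht hv)).trans ?_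
    refine mul_le_mul_of_nonneg_left ?_ (by positivity)
    rw [← norm_neg]
    simpa using hT.norm_apply_sub_le_mul hah ht

lemma norm_one_sub_pow_apply_le_KFun (hT : IsContractionSemigroup T) {t : ℝ} (ht : 0 ≤ t)
    (r : ℕ) (f : B) : ‖((1 - T t) ^ r) f‖ ≤ 2 ^ r * KFun T r f (t ^ r) := by
  rw [← div_le_iff₀' (by positivity)]
  refine le_csInf ⟨_, 0, 0, GenRelIter.zero_zero r, rfl⟩ ?_
  rintro v ⟨g, h, hgh, rfl⟩
  rw [div_le_iff₀' (by positivity)]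
  have h1 := hT.norm_one_sub_pow_apply_le_of_genRelIter ht hgh
  have h2 := norm_pow_apply_le zero_le_two (norm_one_sub_apply_le (hT.contr t ht)) r (f - g)
  have h3 : ((1 - T t) ^ r) f = ((1 - T t) ^ r) (f - g) + ((1 - T t) ^ r) g := by
    rw [← map_add, sub_add_cancel]
  have h4 : (1 : ℝ) ≤ 2 ^ r := one_le_pow₀ one_le_two
  have h5 : 0 ≤ t ^ r * ‖h‖ := by positivity
  rw [h3]
  refine (norm_add_le _ _).trans ?_
  nlinarith

/-- For a holomorphic semigroup, `t A T(nt) f` is controlled by `f - T(t) f` for a suitable `n`. -/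
lemma exists_genRel_le (hT : IsContractionSemigroup T) {N : ℝ} (hN : 0 < N)
    (hhol : ∀ t : ℝ, 0 < t → ∀ f : B, ∃ g : B, GenRel T (T t f) g ∧ t * ‖g‖ ≤ N * ‖f‖) :
    ∃ n : ℕ, ∀ t : ℝ, 0 < t → ∀ f : B, ∃ b : B,
      GenRel T ((T t ^ n) f) b ∧ t * ‖b‖ ≤ (2 + N) * ‖(1 - T t) f‖ := by
  obtain ⟨n, hn⟩ := exists_nat_ge (2 * N)
  have hn0 : (0 : ℝ) < n := by linarith
  refine ⟨n + n, fun t ht f => ?_⟩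
  have hnt : 0 < n * t := by positivity
  have hcomm : ∀ v, 0 < v → Commute (T (n * t)) (T v) := fun v hv => hT.commute hnt.le hv.le
  obtain ⟨a, ha, -⟩ := hhol _ hnt f
  obtain ⟨c, hc, hca⟩ := hhol _ hnt a
  obtain ⟨d, hd, hdf⟩ := hhol _ hnt ((1 - T (n * t)) f)
  have hb : GenRel T ((T t ^ (n + n)) f) (T (n * t) a) := by
    rw [pow_add, ← hT.nat_mul ht.le]
    exact ha.map hcomm
  refine ⟨T (n * t) a, hb, ?_⟩
  set b := T (n * t) a
  have hab : d = a - b := by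
    refine hd.unique ?_
    have := ha.sub (ha.map hcomm)
    simpa using this
  have h1 := norm_one_sub_pow_pow_apply_le (hT.contr t ht.le) n 1 f
  simp only [pow_one] at h1
  rw [hT.nat_mul ht.le] at hdf
  set δ := ‖(1 - T t) f‖
  have h2 : t * ‖d‖ ≤ N * δ := by
    have : n * (t * ‖d‖) ≤ n * (N * δ) := by nlinarith
    exact le_of_mul_le_mul_left this hn0
  have h3 : ‖a‖ ≤ ‖b‖ + ‖d‖ := by
    have : a = b + d := by rw [hab]; abel
    rw [this]
    exact norm_add_le _ _
  have h4 := hT.norm_taylor_le hb hc ht.le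
  have h5 : ‖T t ((T t ^ (n + n)) f) - (T t ^ (n + n)) f‖ ≤ δ := by
    have e : T t ((T t ^ (n + n)) f) - (T t ^ (n + n)) f = - (T t ^ (n + n)) ((1 - T t) f) := by
      have e1 : T t ((T t ^ (n + n)) f) = (T t ^ (n + n)) (T t f) :=
        DFunLike.congr_fun ((Commute.refl (T t)).pow_right (n + n)).eq f
      simp only [sub_apply, one_apply_eq_self, map_sub, neg_sub, e1]
    rw [e, norm_neg]
    exact norm_contraction_pow_apply_le (hT.contr t ht.le) _ _
  have h6 : t * ‖b‖ ≤ δ + t ^ 2 * ‖c‖ := by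
    have e : ‖t • b‖ = t * ‖b‖ := by rw [norm_smul, Real.norm_of_nonneg ht.le]
    rw [← e]
    have := norm_sub_norm_le (t • b) (T t ((T t ^ (n + n)) f) - (T t ^ (n + n)) f)
    rw [norm_sub_rev] at h4
    linarith
  have h7 : 2 * (t * ‖c‖) ≤ ‖a‖ := by
    have : N * (2 * (t * ‖c‖)) ≤ N * ‖a‖ := by
      have : 0 ≤ t * ‖c‖ := by positivity
      nlinarith
    exact le_of_mul_le_mul_left this hN
  nlinarith

lemma exists_genRelIter_le (hT : IsContractionSemigroup T) {n : ℕ} {C : ℝ} (hC : 0 ≤ C) {t : ℝ}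
    (ht : 0 < t)
    (h : ∀ f : B, ∃ b : B, GenRel T ((T t ^ n) f) b ∧ t * ‖b‖ ≤ C * ‖(1 - T t) f‖)
    (k : ℕ) (f : B) : ∃ b : B, GenRelIter T k ((T t ^ (n * k)) f) b ∧
      t ^ k * ‖b‖ ≤ C ^ k * ‖((1 - T t) ^ k) f‖ := by
  induction k generalizing f with
  | zero => exact ⟨f, by simp [GenRelIter], by simp⟩
  | succ k ih =>
    obtain ⟨a, ha, -⟩ := ih f
    obtain ⟨a', ha', haf⟩ := ih ((1 - T t) f)
    obtain ⟨b, hb, hba⟩ := h a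
    have hcomm : ∀ v, 0 < v → Commute (T t ^ n) (T v) := fun v hv =>
      (hT.commute ht.le hv.le).pow_left n
    have e : a' = (1 - T t) a := by
      refine ha'.unique ?_
      have e1 : (T t ^ (n * k)) ((1 - T t) f) = (1 - T t) ((T t ^ (n * k)) f) :=
        DFunLike.congr_fun ((Commute.one_right (T t ^ (n * k))).sub_right
          ((Commute.refl (T t)).pow_left (n * k))).eq f
      rw [e1]
      exact ha.map fun v hv => hT.commute_one_sub ht.le hv
    refine ⟨b, ⟨(T t ^ n) a, ?_, hb⟩, ?_⟩
    · have := ha.map hcomm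
      rwa [← mul_apply_eq_comp, ← pow_add, add_comm, ← Nat.mul_succ] at this
    · rw [← e] at hba
      rw [pow_succ (1 - T t), mul_apply_eq_comp]
      calc t ^ (k + 1) * ‖b‖ = t ^ k * (t * ‖b‖) := by ring
        _ ≤ t ^ k * (C * ‖a'‖) := by gcongr
        _ = C * (t ^ k * ‖a'‖) := by ring
        _ ≤ C * (C ^ k * ‖((1 - T t) ^ k) ((1 - T t) f)‖) := by gcongr
        _ = _ := by ring

/-- Strong converse inequality: for a holomorphic semigroup the K-functional is bounded by the
`p`-th difference with a single step. -/
lemma exists_KFun_le (hT : IsContractionSemigroup T) {N : ℝ} (hN : 0 < N)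
    (hhol : ∀ t : ℝ, 0 < t → ∀ f : B, ∃ g : B, GenRel T (T t f) g ∧ t * ‖g‖ ≤ N * ‖f‖)
    (p : ℕ) :
    ∃ c : ℝ, 0 < c ∧ ∀ t : ℝ, 0 < t → ∀ f : B,
      KFun T p f (t ^ p) ≤ c * ‖((1 - T t) ^ p) f‖ := by
  obtain ⟨n, h⟩ := hT.exists_genRel_le hN hhol
  refine ⟨((n * p : ℕ) : ℝ) ^ p + (2 + N) ^ p * 2 ^ p, by positivity, fun t ht f => ?_⟩
  have hP := hT.contr t ht.le
  set P := T t with hPdef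
  set R := ∑ i ∈ Finset.range p, (1 - P ^ (n * p)) ^ i with hR
  obtain ⟨b, hb, hbR⟩ := hT.exists_genRelIter_le (by positivity) ht (h t ht) p (R f)
  have hg : f - (P ^ (n * p)) (R f) = ((1 - P ^ (n * p)) ^ p) f := by
    have := mul_neg_geom_sum (1 - P ^ (n * p)) p
    rw [sub_sub_cancel, ← hR] at this
    have := DFunLike.congr_fun this f
    simp only [mul_apply_eq_comp, sub_apply,
      one_apply_eq_self] at this
    rw [this, sub_sub_cancel]
  have hRc : ((1 - P) ^ p) (R f) = R (((1 - P) ^ p) f) := by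
    suffices hPR : Commute ((1 - P) ^ p) R from DFunLike.congr_fun hPR.eq f
    refine Commute.sum_right _ _ _ fun i _ => Commute.pow_pow ?_ p i
    have hc : Commute (1 - P) (P ^ (n * p)) :=
      ((Commute.one_left P).sub_left (Commute.refl P)).pow_right _
    exact (Commute.one_right _).sub_right hc
  have h1 := norm_one_sub_pow_pow_apply_le hP (n * p) p f
  have h2 := norm_sum_one_sub_pow_apply_le (norm_contraction_pow_apply_le hP (n * p)) p
    (((1 - P) ^ p) f)
  rw [← hPdef, hRc] at hbR
  refine (KFun_le f (by positivity) hb).trans ?_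
  rw [← hPdef, hg, add_mul, mul_assoc ((2 + N) ^ p)]
  exact add_le_add h1 (hbR.trans (mul_le_mul_of_nonneg_left h2 (by positivity)))

lemma sum_differences_le (hT : IsContractionSemigroup T) {s m : ℝ} (hs : 0 < s) (hm : 0 < m)
    (hstar : ∀ F G : B, (‖F‖ ^ s + m * ‖G‖ ^ s) ^ (1 / s) ≤ max ‖F + G‖ ‖F - G‖)
    {r : ℕ} (hr : 1 ≤ r) {t : ℝ} (ht : 0 < t) (f : B) (n : ℕ) :
    ∑ j ∈ Finset.range n, m * ((((2 : ℝ) ^ r)⁻¹ ^ j) *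
      (2⁻¹ * ‖((1 - T (2 ^ j * t)) ^ (r + 1)) f‖)) ^ s ≤ ‖((1 - T t) ^ r) f‖ ^ s := by
  set q : ℝ := ((2 : ℝ) ^ r)⁻¹ with hq
  have hq0 : 0 < q := by positivity
  suffices H : ∑ j ∈ Finset.range n, m * (q ^ j *
      (2⁻¹ * ‖((1 - T (2 ^ j * t)) ^ (r + 1)) f‖)) ^ s +
      (q ^ n * ‖((1 - T (2 ^ n * t)) ^ r) f‖) ^ s ≤ ‖((1 - T t) ^ r) f‖ ^ s by
    have : 0 ≤ (q ^ n * ‖((1 - T (2 ^ n * t)) ^ r) f‖) ^ s := by positivity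
    linarith
  induction n with
  | zero => simp
  | succ n ih =>
    refine le_trans ?_ ih
    rw [Finset.sum_range_succ, add_assoc]
    refine add_le_add le_rfl ?_
    have hu : 0 < 2 ^ n * t := by positivity
    have h := doubling_step hs hm hstar (hT.contr _ hu.le) r hr f
    have e : T (2 ^ (n + 1) * t) = T (2 ^ n * t) ^ 2 := by
      rw [← hT.nat_mul hu.le, pow_succ]
      congr 1
      push_cast
      ring
    rw [← e, ← hq] at h
    have hmul := mul_le_mul_of_nonneg_left h (Real.rpow_nonneg (pow_nonneg hq0.le n) s)
    rw [mul_add, mul_left_comm, ← Real.mul_rpow (by positivity) (by positivity),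
      ← Real.mul_rpow (by positivity) (by positivity),
      ← Real.mul_rpow (by positivity) (by positivity), ← mul_assoc, ← pow_succ] at hmul
    linarith

end IsContractionSemigroup

end Generator

/-- If `B` satisfies condition (*) with parameters `s ∈ [2,∞)`, `m > 0`, and
`(T(t))_{t≥0}` is a holomorphic C₀ semigroup of contractions on `B` with generator `A`,
then for every `r ≥ 1` there is `C > 0` with
`K_{A^r}(f, t^r) ≥ C (∑_{j=1}^∞ 2^{−jrs} K_{A^{r+1}}(f, 2^{j(r+1)} t^{r+1})^s)^{1/s}`
for all `f ∈ B`, `t > 0` (and the series converges). -/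
theorem stmt11 {B : Type*} [NormedAddCommGroup B] [NormedSpace ℝ B] [CompleteSpace B]
    (s m : ℝ) (hs : 2 ≤ s) (hm : 0 < m)
    (hstar : ∀ F G : B, (‖F‖ ^ s + m * ‖G‖ ^ s) ^ (1 / s) ≤ max ‖F + G‖ ‖F - G‖)
    (T : ℝ → B →L[ℝ] B)
    (hT0 : T 0 = 1)
    (hTsem : ∀ t u : ℝ, 0 ≤ t → 0 ≤ u → T (t + u) = T t ∘L T u)
    (hTc0 : ∀ f : B, Tendsto (fun t : ℝ => T t f) (nhdsWithin 0 (Set.Ioi 0)) (nhds f))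
    (hTcontr : ∀ t : ℝ, 0 ≤ t → ∀ f : B, ‖T t f‖ ≤ ‖f‖)
    (hhol : ∃ N : ℝ, 0 < N ∧ ∀ t : ℝ, 0 < t → ∀ f : B,
      ∃ g : B, GenRel T (T t f) g ∧ t * ‖g‖ ≤ N * ‖f‖)
    (r : ℕ) (hr : 1 ≤ r) :
    ∃ C : ℝ, 0 < C ∧ ∀ f : B, ∀ t : ℝ, 0 < t →
      Summable (fun j : ℕ =>
        (2 : ℝ) ^ (-((j : ℝ) + 1) * r * s) *
          KFun T (r + 1) f ((2 : ℝ) ^ (((j : ℝ) + 1) * ((r : ℝ) + 1)) * t ^ (r + 1)) ^ s) ∧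
      C * (∑' j : ℕ,
          (2 : ℝ) ^ (-((j : ℝ) + 1) * r * s) *
            KFun T (r + 1) f ((2 : ℝ) ^ (((j : ℝ) + 1) * ((r : ℝ) + 1)) * t ^ (r + 1)) ^ s)
          ^ (1 / s)
        ≤ KFun T r f (t ^ r) := by
  have hT : IsContractionSemigroup T := ⟨hT0, hTsem, hTc0, hTcontr⟩
  have hs0 : 0 < s := by linarith
  obtain ⟨N, hN, hhol⟩ := hhol
  obtain ⟨c, hc, hK⟩ := hT.exists_KFun_le hN hhol (r + 1)
  set M : ℝ := (2 * c) ^ s / m with hM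
  have hM0 : 0 < M := by positivity
  refine ⟨((M ^ (1 / s)) * 2 ^ r)⁻¹, by positivity, fun f t ht => ?_⟩
  set F : ℕ → ℝ := fun j : ℕ =>
    (2 : ℝ) ^ (-((j : ℝ) + 1) * r * s) *
      KFun T (r + 1) f ((2 : ℝ) ^ (((j : ℝ) + 1) * ((r : ℝ) + 1)) * t ^ (r + 1)) ^ s with hF
  set a : ℕ → ℝ := fun j => m * ((((2 : ℝ) ^ r)⁻¹ ^ j) *
      (2⁻¹ * ‖((1 - T (2 ^ j * t)) ^ (r + 1)) f‖)) ^ s with ha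
  have ha0 : ∀ j, 0 ≤ a j := fun j => by simp only [ha]; positivity
  have hKn : ∀ j : ℕ,
      0 ≤ KFun T (r + 1) f ((2 : ℝ) ^ (((j : ℝ) + 1) * ((r : ℝ) + 1)) * t ^ (r + 1)) :=
    fun j => KFun_nonneg _ _ (by positivity)
  have hF0 : ∀ j, 0 ≤ F j := fun j =>
    mul_nonneg (by positivity) (Real.rpow_nonneg (hKn j) s)
  have hFa : ∀ j, F j ≤ M * a (j + 1) := by
    intro j
    have e1 : (2 : ℝ) ^ (((j : ℝ) + 1) * ((r : ℝ) + 1)) * t ^ (r + 1)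
        = (2 ^ (j + 1) * t) ^ (r + 1) := by
      have : ((j : ℝ) + 1) * ((r : ℝ) + 1) = (((j + 1) * (r + 1) : ℕ) : ℝ) := by push_cast; ring
      rw [this, Real.rpow_natCast, pow_mul, mul_pow]
    have e2 : (2 : ℝ) ^ (-((j : ℝ) + 1) * r * s) = (((2 : ℝ) ^ r)⁻¹ ^ (j + 1)) ^ s := by
      have : -((j : ℝ) + 1) * r * s = -((r * (j + 1) : ℕ) : ℝ) * s := by push_cast; ring
      rw [this, Real.rpow_mul zero_le_two, Real.rpow_neg zero_le_two, Real.rpow_natCast, pow_mul,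
        inv_pow]
    have hle := hK (2 ^ (j + 1) * t) (by positivity) f
    have hn := hKn j
    simp only [hF, ha]
    rw [e1] at hn ⊢
    rw [e2, hM, ← Real.mul_rpow (by positivity) hn, div_mul_eq_mul_div, mul_left_comm,
      mul_div_cancel_left₀ _ hm.ne', ← Real.mul_rpow (by positivity) (by positivity)]
    refine Real.rpow_le_rpow (by positivity) ?_ hs0.le
    calc _ ≤ (((2 : ℝ) ^ r)⁻¹ ^ (j + 1)) *
          (c * ‖((1 - T (2 ^ (j + 1) * t)) ^ (r + 1)) f‖) := by gcongr
      _ = _ := by ring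
  have hsum : ∀ n, ∑ j ∈ Finset.range n, F j ≤ M * ‖((1 - T t) ^ r) f‖ ^ s := by
    intro n
    have h1 := hT.sum_differences_le hs0 hm hstar hr ht f (n + 1)
    have h2 : ∑ j ∈ Finset.range (n + 1), a j ≤ ‖((1 - T t) ^ r) f‖ ^ s := h1
    rw [Finset.sum_range_succ'] at h2
    calc ∑ j ∈ Finset.range n, F j ≤ ∑ j ∈ Finset.range n, M * a (j + 1) :=
          Finset.sum_le_sum fun j _ => hFa j
      _ = M * ∑ j ∈ Finset.range n, a (j + 1) := by rw [Finset.mul_sum]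
      _ ≤ _ := by
        gcongr
        linarith [ha0 0]
  refine ⟨summable_of_sum_range_le hF0 hsum, ?_⟩
  have hts : ∑' j, F j ≤ M * ‖((1 - T t) ^ r) f‖ ^ s := Real.tsum_le_of_sum_range_le hF0 hsum
  rw [inv_mul_le_iff₀ (by positivity)]
  calc (∑' j, F j) ^ (1 / s) ≤ (M * ‖((1 - T t) ^ r) f‖ ^ s) ^ (1 / s) :=
        Real.rpow_le_rpow (tsum_nonneg hF0) hts (by positivity)
    _ = M ^ (1 / s) * ‖((1 - T t) ^ r) f‖ := by
        rw [Real.mul_rpow hM0.le (by positivity), one_div,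
          Real.rpow_rpow_inv (norm_nonneg _) hs0.ne']
    _ ≤ M ^ (1 / s) * (2 ^ r * KFun T r f (t ^ r)) := by
        gcongr
        exact hT.norm_one_sub_pow_apply_le_KFun ht.le r f
    _ = _ := by ring
end
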